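/- For every k ≥ 0, liminf_{n→∞} φ(ψ_k(n)) · log log n / ψ_k(n) = e^{−γ}, where ψ_k denotes the k-fold iterate of the Dedekind function and γ is the Euler–Mascheroni constant. -/

import Mathlib

open Filter Real

/-- The Dedekind `ψ` function: `ψ(n) = n * ∏_{p ∣ n} (1 + 1/p)`,
i.e. `ψ(p^a) = p^(a-1) * (p + 1)` multiplicatively. -/
def dedekindPsi (n : ℕ) : ℕ := n.factorization.prod fun p a => p ^ (a - 1) * (p + 1)

lemma log_factorial_eq_sum_primesLE (N : ℕ) :
    log (N.factorial : ℝ) = ∑ p ∈ N.primesLE, (N.factorial.factorization p : ℝ) * log p := by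
  rw [log_nat_eq_sum_factorization]
  refine Finsupp.sum_of_support_subset _ (fun p hp => ?_) _ (by simp)
  rw [Nat.support_factorization] at hp
  have hp' := Nat.prime_of_mem_primeFactors hp
  exact Nat.mem_primesLE.2
    ⟨(hp'.dvd_factorial).1 (Nat.dvd_of_mem_primeFactors hp), hp'⟩

lemma div_le_factorization_factorial {p : ℕ} (hp : p.Prime) (N : ℕ) :
    N / p ≤ N.factorial.factorization p := by
  rw [Nat.factorization_factorial hp (b := Nat.log p N + 2) (by omega)]
  refine le_trans (by simp) (Finset.single_le_sum (f := fun i => N / p ^ i)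
    (fun i _ => Nat.zero_le _) (Finset.mem_Ico.2 ⟨le_refl 1, by omega⟩))

lemma mul_log_sub_le_log_factorial (N : ℕ) :
    N * log N - N ≤ log (N.factorial : ℝ) := by
  rcases Nat.eq_zero_or_pos N with rfl | hN
  · simp
  have hN' : (0 : ℝ) < N := by exact_mod_cast hN
  have hf : (0 : ℝ) < N.factorial := by exact_mod_cast N.factorial_pos
  have h := log_le_log (by positivity) (pow_div_factorial_le_exp (N : ℝ) hN'.le N)
  rw [log_div (by positivity) hf.ne', log_pow, log_exp] at h
  linarith

lemma log_factorial_le_mul_log (N : ℕ) : log (N.factorial : ℝ) ≤ N * log N := by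
  rcases Nat.eq_zero_or_pos N with rfl | hN
  · simp
  have hf : (0 : ℝ) < N.factorial := by exact_mod_cast N.factorial_pos
  rw [← log_pow]
  exact log_le_log hf (by exact_mod_cast Nat.factorial_le_pow N)

lemma log_div_mul_pred_le {p : ℕ} (hp : 2 ≤ p) :
    log p / (p * (p - 1)) ≤ 4 * ((p : ℝ) ^ (3 / 2 : ℝ))⁻¹ := by
  have hp' : (2 : ℝ) ≤ p := by exact_mod_cast hp
  have hlog : log p ≤ (p : ℝ) ^ (1 / 2 : ℝ) / (1 / 2) :=
    log_le_rpow_div (by linarith) (by norm_num)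
  have hpow : (p : ℝ) ^ (1 / 2 : ℝ) * (p : ℝ) ^ (3 / 2 : ℝ) = p * p := by
    rw [← rpow_add (by linarith)]
    norm_num [sq]
  have h0 : 0 < (p : ℝ) ^ (3 / 2 : ℝ) := by positivity
  have h1 : (0 : ℝ) < p - 1 := by linarith
  rw [← div_eq_mul_inv, div_le_div_iff₀ (by positivity) h0]
  nlinarith [mul_le_mul_of_nonneg_right hlog h0.le]

/-- Mertens' first theorem. -/
theorem exists_abs_sum_log_div_sub_log_le :
    ∃ C : ℝ, ∀ N : ℕ, |∑ p ∈ N.primesLE, log p / p - log N| ≤ C := by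
  have hsum : Summable fun n : ℕ => 4 * ((n : ℝ) ^ (3 / 2 : ℝ))⁻¹ :=
    (summable_nat_rpow_inv.2 (by norm_num)).mul_left 4
  set B : ℝ := ∑' n : ℕ, 4 * ((n : ℝ) ^ (3 / 2 : ℝ))⁻¹ with hB
  have hB0 : 0 ≤ B := tsum_nonneg fun n => by positivity
  have hl4 : 0 ≤ log 4 := log_nonneg (by norm_num)
  refine ⟨1 + B + log 4, fun N => ?_⟩
  rcases Nat.eq_zero_or_pos N with rfl | hN
  · simp; linarith
  have hN' : (0 : ℝ) < N := by exact_mod_cast hN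
  have hupper : N * ∑ p ∈ N.primesLE, log p / p - log 4 * N ≤ log (N.factorial : ℝ) := by
    have htheta := Chebyshev.theta_le_log4_mul_x hN'.le
    rw [Chebyshev.theta_eq_sum_primesLE_log] at htheta
    rw [log_factorial_eq_sum_primesLE]
    refine le_trans (sub_le_sub_left htheta _) ?_
    rw [Finset.mul_sum, ← Finset.sum_sub_distrib]
    refine Finset.sum_le_sum fun p hp => ?_
    have hpp := Nat.prime_of_mem_primesLE hp
    have hlog : 0 ≤ log (p : ℝ) := log_natCast_nonneg p
    have hfl : (N : ℝ) / p - 1 ≤ N.factorial.factorization p := by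
      have h1 : ((N / p : ℕ) : ℝ) ≤ N.factorial.factorization p := by
        exact_mod_cast div_le_factorization_factorial hpp N
      have h2 := Nat.lt_floor_add_one ((N : ℝ) / p)
      rw [Nat.floor_div_natCast, Nat.floor_natCast] at h2
      linarith
    calc N * (log p / p) - log p = ((N : ℝ) / p - 1) * log p := by ring
      _ ≤ _ := mul_le_mul_of_nonneg_right hfl hlog
  have hlower : log (N.factorial : ℝ) ≤ N * ∑ p ∈ N.primesLE, log p / p + N * B := by
    rw [log_factorial_eq_sum_primesLE]
    have hBs : ∑ p ∈ N.primesLE, log (p : ℝ) / (p * (p - 1)) ≤ B :=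
      (Finset.sum_le_sum fun p hp =>
        log_div_mul_pred_le (Nat.prime_of_mem_primesLE hp).two_le).trans
        (hsum.sum_le_tsum _ fun n _ => by positivity)
    refine le_trans ?_ (add_le_add_right (mul_le_mul_of_nonneg_left hBs hN'.le) _)
    rw [Finset.mul_sum, Finset.mul_sum, ← Finset.sum_add_distrib]
    refine Finset.sum_le_sum fun p hp => ?_
    have hpp := Nat.prime_of_mem_primesLE hp
    have hp2 : (2 : ℝ) ≤ p := by exact_mod_cast hpp.two_le
    have hlog : 0 ≤ log (p : ℝ) := log_natCast_nonneg p
    have hfl : (N.factorial.factorization p : ℝ) ≤ N / (p - 1) := by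
      have h1 : (N.factorial.factorization p : ℝ) ≤ ((N / (p - 1) : ℕ) : ℝ) := by
        exact_mod_cast Nat.factorization_factorial_le_div_pred hpp N
      refine h1.trans (Nat.cast_div_le.trans (le_of_eq ?_))
      rw [Nat.cast_pred hpp.pos]
    refine (mul_le_mul_of_nonneg_right hfl hlog).trans (le_of_eq ?_)
    have h1 : (p : ℝ) - 1 ≠ 0 := by linarith
    field_simp
    ring
  have h1 := mul_log_sub_le_log_factorial N
  have h2 := log_factorial_le_mul_log N
  rw [abs_le]
  constructor
  · refine le_of_mul_le_mul_left ?_ hN'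
    nlinarith [mul_nonneg hN'.le hl4]
  · refine le_of_mul_le_mul_left ?_ hN'
    nlinarith [mul_nonneg hN'.le hB0]
lemma sum_range_log_sub_log_pred (n : ℕ) :
    ∑ m ∈ Finset.range (n + 1), (log m - log ((m : ℝ) - 1)) = log n := by
  induction n with
  | zero => simp
  | succ n ih => rw [Finset.sum_range_succ, ih]; push_cast; simp

lemma exists_tendsto_sum_log_sub_div_log_sub_log_log :
    ∃ c : ℝ, Tendsto (fun n : ℕ => ∑ m ∈ Finset.range (n + 3),
      (log (max m 2 : ℝ))⁻¹ * (log m - log ((m : ℝ) - 1)) - log (log ((n : ℝ) + 2)))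
      atTop (nhds c) := by
  set a : ℕ → ℝ := fun j => log ((j : ℝ) + 2) with ha
  have ha0 (j : ℕ) : 0 < a j := log_pos (by have : (0 : ℝ) ≤ j := j.cast_nonneg; linarith)
  have hlt (j : ℕ) : a j < a (j + 1) := log_lt_log (by positivity) (by push_cast; linarith)
  have hle (j : ℕ) : a (j + 1) - a j ≤ 1 := by
    have hj : (0 : ℝ) ≤ j := j.cast_nonneg
    simp only [ha]
    rw [← log_div (by positivity) (by positivity)]
    refine (log_le_sub_one_of_pos (by positivity)).trans ?_
    rw [sub_le_iff_le_add, div_le_iff₀ (by positivity)]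
    push_cast
    linarith
  set b : ℕ → ℝ := fun j => log (a (j + 1)) - log (a j) - (a (j + 1))⁻¹ * (a (j + 1) - a j)
    with hb
  have hb0 (j : ℕ) : 0 ≤ b j := by
    have h := one_sub_inv_le_log_of_pos (div_pos (ha0 (j + 1)) (ha0 j))
    rw [log_div (ha0 _).ne' (ha0 _).ne', inv_div] at h
    have h2 : (a (j + 1))⁻¹ * (a (j + 1) - a j) = 1 - a j / a (j + 1) := by
      field_simp [(ha0 (j + 1)).ne']
    simp only [hb, h2]
    linarith
  have hb1 (j : ℕ) : b j ≤ (a j)⁻¹ - (a (j + 1))⁻¹ := by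
    have h := log_le_sub_one_of_pos (div_pos (ha0 (j + 1)) (ha0 j))
    rw [log_div (ha0 _).ne' (ha0 _).ne'] at h
    have h2 : a (j + 1) / a j - 1 - (a (j + 1))⁻¹ * (a (j + 1) - a j)
        = (a (j + 1) - a j) * ((a j)⁻¹ - (a (j + 1))⁻¹) := by
      field_simp [(ha0 (j + 1)).ne', (ha0 j).ne']
    have h3 : 0 ≤ (a j)⁻¹ - (a (j + 1))⁻¹ := sub_nonneg.2 (inv_anti₀ (ha0 j) (hlt j).le)
    have h4 := mul_le_mul_of_nonneg_right (hle j) h3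
    simp only [hb]
    linarith
  have hsum : Summable b := by
    refine summable_of_sum_range_le (c := (a 0)⁻¹) hb0 fun n => ?_
    refine (Finset.sum_le_sum fun j _ => hb1 j).trans ?_
    rw [Finset.sum_range_sub']
    have := inv_pos.2 (ha0 n)
    linarith
  set F : ℕ → ℝ := fun m => (log (max m 2 : ℝ))⁻¹ * (log m - log ((m : ℝ) - 1)) with hF
  have hid (n : ℕ) : ∑ m ∈ Finset.range (n + 3), F m - log (a n)
      = (∑ m ∈ Finset.range 3, F m - log (a 0)) - ∑ j ∈ Finset.range n, b j := by
    induction n with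
    | zero => simp
    | succ n ih =>
      rw [show n + 1 + 3 = (n + 3) + 1 by ring, Finset.sum_range_succ, Finset.sum_range_succ b]
      have hFn : F (n + 3) = (a (n + 1))⁻¹ * (a (n + 1) - a n) := by
        simp only [hF, ha]
        have hn : (0 : ℝ) ≤ n := n.cast_nonneg
        rw [max_eq_left (by push_cast; linarith)]
        push_cast
        rw [show (n : ℝ) + 1 + 2 = n + 3 by ring, show (n : ℝ) + 3 - 1 = n + 2 by ring]
      rw [hFn]
      simp only [hb]
      linarith
  exact ⟨_, (hsum.hasSum.tendsto_sum_nat.const_sub _).congr fun n => (hid n).symm⟩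

/-- Mertens' second theorem, without the value of the constant. -/
theorem exists_tendsto_sum_inv_primesLE_sub_log_log :
    ∃ M : ℝ, Tendsto (fun N : ℕ => ∑ p ∈ N.primesLE, (p : ℝ)⁻¹ - log (log N)) atTop (nhds M) := by
  obtain ⟨C, hC⟩ := exists_abs_sum_log_div_sub_log_le
  obtain ⟨c, hc⟩ := exists_tendsto_sum_log_sub_div_log_sub_log_log
  set f : ℕ → ℝ := fun m => (log (max m 2 : ℝ))⁻¹ with hf
  set z : ℕ → ℝ := fun m => (if m.Prime then log m / m else 0) - (log m - log ((m : ℝ) - 1)) with hz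
  have hmax (m : ℕ) : 0 < log (max m 2 : ℝ) :=
    log_pos (lt_of_lt_of_le (by norm_num) (le_max_right _ _))
  have hanti : Antitone f := fun m n hmn => by
    refine inv_anti₀ (hmax m) (log_le_log (by positivity) ?_)
    exact max_le_max (by exact_mod_cast hmn) le_rfl
  have hf0 : Tendsto f atTop (nhds 0) := by
    refine tendsto_inv_atTop_zero.comp (tendsto_log_atTop.comp ?_)
    exact tendsto_atTop_mono (fun n => le_max_left _ _) tendsto_natCast_atTop_atTop
  have hbound (n : ℕ) : ‖∑ i ∈ Finset.range n, z i‖ ≤ C := by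
    rcases n with _ | n
    · simpa using (abs_nonneg _).trans (hC 0)
    · rw [Finset.sum_sub_distrib, sum_range_log_sub_log_pred, ← Finset.sum_filter]
      exact hC n
  obtain ⟨d, hd⟩ := cauchySeq_tendsto_of_complete
    (hanti.cauchySeq_series_mul_of_tendsto_zero_of_bounded hf0 hbound)
  refine ⟨d + c, (tendsto_add_atTop_iff_nat 2).1 ?_⟩
  refine (((tendsto_add_atTop_iff_nat 3).2 hd).add hc).congr fun n => ?_
  have hS : ∑ p ∈ (n + 2).primesLE, (p : ℝ)⁻¹
      = ∑ m ∈ Finset.range (n + 3), (f m * z m + f m * (log m - log ((m : ℝ) - 1))) := by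
    rw [Nat.primesLE_eq_filter_range, Finset.sum_filter]
    refine Finset.sum_congr rfl fun m _ => ?_
    split_ifs with hm
    · have h2 : (2 : ℝ) ≤ m := by exact_mod_cast hm.two_le
      have hl : log (m : ℝ) ≠ 0 := (log_pos (by linarith)).ne'
      simp only [hf, hz, if_pos hm, max_eq_left h2]
      field_simp
      ring
    · simp only [hz, if_neg hm]
      ring
  rw [hS, Finset.sum_add_distrib]
  simp only [smul_eq_mul]
  push_cast
  ring

open MeasureTheory in
/-- An Abelian theorem for general Dirichlet series: if the partial sums `D u` of the weights `w i`
over the exponents `l i ≤ u` converge to `L`, then so does `∑ w i * exp (-δ * l i)` as `δ → 0+`. -/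
theorem tendsto_tsum_mul_exp_neg_of_tendsto {ι : Type*} [Countable ι] {w l : ι → ℝ} {D : ℝ → ℝ}
    {L : ℝ} (hl : ∀ i, 0 ≤ l i) (hw : ∀ δ > 0, Summable fun i => |w i| * exp (-(δ * l i)))
    (hDm : Measurable D) (hD : ∀ u ≥ 0, HasSum (fun i => if l i ≤ u then w i else 0) (D u))
    (hL : Tendsto D atTop (nhds L)) :
    Tendsto (fun δ : ℝ => ∑' i, w i * exp (-(δ * l i))) (nhdsWithin 0 (Set.Ioi 0)) (nhds L) := by
  obtain ⟨C, hC⟩ : ∃ C, ∀ u ≥ 0, |D u| ≤ C := by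
    obtain ⟨U, hU⟩ := eventually_atTop.1 (hL.abs.eventually (gt_mem_nhds (lt_add_one |L|)))
    refine ⟨max (|L| + 1) (∑' i, exp U * (|w i| * exp (-(1 * l i)))), fun u hu => ?_⟩
    rcases le_total U u with h | h
    · exact (hU u h).le.trans (le_max_left _ _)
    · refine le_trans ?_ (le_max_right _ _)
      have hs := (hw 1 one_pos).mul_left (exp U)
      rw [← (hD u hu).tsum_eq, ← norm_eq_abs]
      refine tsum_of_norm_bounded hs.hasSum fun i => ?_
      split_ifs with hi
      · rw [mul_left_comm, ← exp_add, norm_eq_abs]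
        exact le_mul_of_one_le_right (abs_nonneg _) (one_le_exp (by linarith))
      · simp only [norm_zero]
        positivity
  have hint : IntegrableOn (fun t : ℝ => exp (-t)) (Set.Ioi 0) := by
    simpa using exp_neg_integrableOn_Ioi 0 one_pos
  have hind (c : ℝ) (hc : 0 ≤ c) :
      ∫ t in Set.Ioi (0 : ℝ), (Set.Ici c).indicator (fun t => exp (-t)) t = exp (-c) := by
    rw [← integral_Ici_eq_integral_Ioi, setIntegral_indicator measurableSet_Ici,
      Set.inter_eq_self_of_subset_right (Set.Ici_subset_Ici.2 hc), integral_Ici_eq_integral_Ioi,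
      integral_exp_neg_Ioi]
  have hrepr (δ : ℝ) (hδ : 0 < δ) :
      ∫ t in Set.Ioi (0 : ℝ), exp (-t) * D (t / δ) = ∑' i, w i * exp (-(δ * l i)) := by
    have hF (i : ι) : Integrable (fun t => w i * (Set.Ici (δ * l i)).indicator
        (fun t => exp (-t)) t) (volume.restrict (Set.Ioi 0)) :=
      (hint.indicator measurableSet_Ici).const_mul _
    have hδl (i : ι) : 0 ≤ δ * l i := mul_nonneg hδ.le (hl i)
    have hnorm (i : ι) (t : ℝ) : ‖w i * (Set.Ici (δ * l i)).indicator (fun t => exp (-t)) t‖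
        = |w i| * (Set.Ici (δ * l i)).indicator (fun t => exp (-t)) t := by
      rw [norm_mul, norm_eq_abs, norm_eq_abs,
        abs_of_nonneg (Set.indicator_nonneg (fun _ _ => (exp_pos _).le) _)]
    have key := integral_tsum_of_summable_integral_norm hF (by
      simp only [hnorm, integral_const_mul, hind _ (hδl _)]
      exact hw δ hδ)
    simp only [integral_const_mul, hind _ (hδl _)] at key
    rw [key]
    refine setIntegral_congr_fun measurableSet_Ioi fun t ht => ?_
    rw [← (hD (t / δ) (div_nonneg (le_of_lt ht) hδ.le)).tsum_eq, ← tsum_mul_left]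
    refine tsum_congr fun i => ?_
    simp only [Set.indicator_apply, Set.mem_Ici, le_div_iff₀' hδ]
    split_ifs <;> ring
  have hlim : Tendsto (fun δ : ℝ => ∫ t in Set.Ioi (0 : ℝ), exp (-t) * D (t / δ))
      (nhdsWithin 0 (Set.Ioi 0)) (nhds (∫ t in Set.Ioi (0 : ℝ), exp (-t) * L)) := by
    refine tendsto_integral_filter_of_dominated_convergence (fun t => exp (-t) * C) ?_ ?_
      (hint.mul_const C) ?_
    · exact Eventually.of_forall fun δ => (by fun_prop : Measurable _).aestronglyMeasurable
    · filter_upwards [self_mem_nhdsWithin] with δ hδ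
      filter_upwards [ae_restrict_mem measurableSet_Ioi] with t ht
      rw [norm_mul, norm_of_nonneg (exp_pos _).le]
      exact mul_le_mul_of_nonneg_left (hC _ (div_nonneg (le_of_lt ht) (le_of_lt hδ)))
        (exp_pos _).le
    · filter_upwards [ae_restrict_mem measurableSet_Ioi] with t ht
      refine (hL.comp ?_).const_mul _
      exact tendsto_inv_nhdsGT_zero.const_mul_atTop ht
  rw [integral_mul_const, integral_exp_neg_Ioi_zero, one_mul] at hlim
  refine hlim.congr' ?_
  filter_upwards [self_mem_nhdsWithin] with δ hδ using hrepr δ hδ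

/-- The remainder `-log (1 - x) - x = x ^ 2 / 2 + x ^ 3 / 3 + ⋯`. -/
noncomputable def logRemainder (x : ℝ) : ℝ := -log (1 - x) - x

lemma logRemainder_nonneg {x : ℝ} (hx : x < 1) : 0 ≤ logRemainder x := by
  have := log_le_sub_one_of_pos (sub_pos.2 hx)
  unfold logRemainder
  linarith

lemma logRemainder_le {x : ℝ} (hx : x ≤ 1 / 2) : logRemainder x ≤ 2 * x ^ 2 := by
  have h0 : 0 < 1 - x := by linarith
  have h := one_sub_inv_le_log_of_pos h0
  have h2 : (1 - x)⁻¹ - 1 - x ≤ 2 * x ^ 2 := by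
    rw [sub_sub, sub_le_iff_le_add, inv_le_iff_one_le_mul₀ h0]
    nlinarith [mul_nonneg (sq_nonneg x) (by linarith : 0 ≤ 1 - 2 * x)]
  unfold logRemainder
  linarith

lemma neg_log_one_sub (x : ℝ) : -log (1 - x) = x + logRemainder x := by
  unfold logRemainder
  ring

lemma rpow_neg_le_inv_of_prime {p : ℕ} (hp : p.Prime) {s : ℝ} (hs : 1 ≤ s) :
    (p : ℝ) ^ (-s) ≤ (p : ℝ)⁻¹ := by
  rw [← rpow_neg_one]
  exact rpow_le_rpow_of_exponent_le (by exact_mod_cast hp.one_le) (by linarith)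

lemma inv_le_half_of_prime {p : ℕ} (hp : p.Prime) : (p : ℝ)⁻¹ ≤ 1 / 2 := by
  rw [one_div]
  exact inv_anti₀ two_pos (by exact_mod_cast hp.two_le)

lemma norm_ite_prime_logRemainder_le {s : ℝ} (hs : 1 ≤ s) (n : ℕ) :
    ‖if n.Prime then logRemainder ((n : ℝ) ^ (-s)) else 0‖ ≤ 2 * ((n : ℝ) ^ 2)⁻¹ := by
  split_ifs with hn
  · have h1 := rpow_neg_le_inv_of_prime hn hs
    have h2 := inv_le_half_of_prime hn
    rw [norm_of_nonneg (logRemainder_nonneg (by linarith))]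
    refine (logRemainder_le (h1.trans h2)).trans ?_
    rw [← inv_pow]
    gcongr
  · simp only [norm_zero]
    positivity

lemma summable_two_mul_inv_sq : Summable fun n : ℕ => 2 * ((n : ℝ) ^ 2)⁻¹ :=
  (summable_nat_pow_inv.2 one_lt_two).mul_left 2

lemma summable_ite_prime_logRemainder {s : ℝ} (hs : 1 ≤ s) :
    Summable fun n : ℕ => if n.Prime then logRemainder ((n : ℝ) ^ (-s)) else 0 :=
  summable_two_mul_inv_sq.of_norm_bounded (norm_ite_prime_logRemainder_le hs)

lemma tendsto_tsum_ite_prime_logRemainder :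
    Tendsto (fun δ : ℝ => ∑' n : ℕ, if n.Prime then logRemainder ((n : ℝ) ^ (-(1 + δ))) else 0)
      (nhdsWithin 0 (Set.Ioi 0))
      (nhds (∑' n : ℕ, if n.Prime then logRemainder (n : ℝ)⁻¹ else 0)) := by
  refine tendsto_tsum_of_dominated_convergence summable_two_mul_inv_sq (fun n => ?_) ?_
  · split_ifs with hn
    · refine tendsto_nhdsWithin_of_tendsto_nhds ?_
      have h0 : (0 : ℝ) < n := by exact_mod_cast hn.pos
      have h1 : (1 : ℝ) - (n : ℝ) ^ (-(1 + 0) : ℝ) ≠ 0 := by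
        have := inv_le_half_of_prime hn
        rw [add_zero, rpow_neg_one]
        linarith
      have hc : ContinuousAt (fun δ : ℝ => (n : ℝ) ^ (-(1 + δ))) 0 :=
        (continuous_const.rpow (by fun_prop) fun _ => Or.inl h0.ne').continuousAt
      have : ContinuousAt (fun δ : ℝ => logRemainder ((n : ℝ) ^ (-(1 + δ)))) 0 :=
        ((continuousAt_const.sub hc).log h1).neg.sub hc
      simpa [ContinuousAt, rpow_neg_one] using this
    · exact tendsto_const_nhds
  · filter_upwards [self_mem_nhdsWithin] with δ hδ
    exact norm_ite_prime_logRemainder_le (by have : (0 : ℝ) < δ := hδ; linarith)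

lemma summable_ite_prime_rpow {s : ℝ} (hs : 1 < s) :
    Summable fun n : ℕ => if n.Prime then (n : ℝ) ^ (-s) else 0 := by
  refine (summable_nat_rpow.2 (by linarith : -s < -1)).of_norm_bounded fun n => ?_
  split_ifs
  · rw [norm_of_nonneg (by positivity)]
  · simp only [norm_zero]
    positivity

/-- The logarithm of the Euler product of the real zeta function. -/
lemma log_tsum_rpow_eq {s : ℝ} (hs : 1 < s) :
    log (∑' n : ℕ, 1 / (n : ℝ) ^ s) = ∑' n : ℕ, (if n.Prime then (n : ℝ) ^ (-s) else 0)
      + ∑' n : ℕ, if n.Prime then logRemainder ((n : ℝ) ^ (-s)) else 0 := by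
  let f : ℕ →*₀ ℝ :=
    { toFun := fun n => (n : ℝ) ^ (-s)
      map_zero' := by simp [zero_rpow (by linarith : -s ≠ 0)]
      map_one' := by simp
      map_mul' := fun m n => by
        push_cast
        exact mul_rpow m.cast_nonneg n.cast_nonneg }
  have hfa (n : ℕ) : f n = (n : ℝ) ^ (-s) := rfl
  have hf0 (n : ℕ) : 0 ≤ f n := by rw [hfa]; positivity
  have hfsum : Summable f := summable_nat_rpow.2 (by linarith : -s < -1)
  have hZ : ∑' n : ℕ, 1 / (n : ℝ) ^ s = ∑' n, f n :=
    tsum_congr fun n => by rw [hfa, rpow_neg n.cast_nonneg, one_div]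
  have hpos : 0 < ∑' n, f n := hfsum.tsum_pos hf0 1 (by simp)
  have hprod := (EulerProduct.eulerProduct_completely_multiplicative (f := f) hfsum.norm).log
    hpos.ne'
  rw [hZ]
  refine tendsto_nhds_unique hprod ?_
  have hsum := ((summable_ite_prime_rpow hs).hasSum.add
    (summable_ite_prime_logRemainder hs.le).hasSum).tendsto_sum_nat
  refine hsum.congr fun N => ?_
  have hlt {p : ℕ} (hp : p.Prime) : f p < 1 :=
    ((rpow_neg_le_inv_of_prime hp hs.le).trans (inv_le_half_of_prime hp)).trans_lt (by norm_num)
  rw [log_prod fun p hp => inv_ne_zero (sub_pos.2 (hlt (Nat.prime_of_mem_primesBelow hp))).ne',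
    Nat.primesBelow, Finset.sum_filter]
  refine Finset.sum_congr rfl fun n _ => ?_
  split_ifs
  · rw [log_inv, neg_log_one_sub, hfa]
  · simp

lemma tendsto_tsum_prime_rpow_add_log :
    Tendsto (fun δ : ℝ => ∑' n : ℕ, (if n.Prime then (n : ℝ) ^ (-(1 + δ)) else 0) + log δ)
      (nhdsWithin 0 (Set.Ioi 0))
      (nhds (-∑' n : ℕ, if n.Prime then logRemainder (n : ℝ)⁻¹ else 0)) := by
  have hshift : Tendsto (fun δ : ℝ => 1 + δ) (nhdsWithin 0 (Set.Ioi 0))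
      (nhdsWithin 1 (Set.Ioi 1)) := by
    refine tendsto_nhdsWithin_iff.2 ⟨tendsto_nhdsWithin_of_tendsto_nhds ?_, ?_⟩
    · simpa using (by fun_prop : Continuous fun δ : ℝ => 1 + δ).tendsto 0
    · filter_upwards [self_mem_nhdsWithin] with δ hδ
      simpa using hδ
  have hzeta := ((tendsto_sub_mul_tsum_nat_rpow).comp hshift).log one_ne_zero
  have h := hzeta.sub tendsto_tsum_ite_prime_logRemainder
  rw [log_one, zero_sub] at h
  refine h.congr' ?_
  filter_upwards [self_mem_nhdsWithin] with δ hδ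
  have hδ0 : (0 : ℝ) < δ := hδ
  have hs : 1 < 1 + δ := by linarith
  have hpos : 0 < ∑' n : ℕ, 1 / (n : ℝ) ^ (1 + δ) :=
    (summable_one_div_nat_rpow.2 hs).tsum_pos (fun n => by positivity) 1 (by simp)
  simp only [Function.comp_apply]
  rw [add_sub_cancel_left, log_mul hδ0.ne' hpos.ne', log_tsum_rpow_eq hs]
  ring

lemma tendsto_log_natFloor_sub_log :
    Tendsto (fun x : ℝ => log ⌊x⌋₊ - log x) atTop (nhds 0) := by
  have h := (tendsto_nat_floor_div_atTop (R := ℝ)).log one_ne_zero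
  rw [log_one] at h
  refine h.congr' ?_
  filter_upwards [eventually_ge_atTop 1] with x hx
  have hfl : (⌊x⌋₊ : ℝ) ≠ 0 := by exact_mod_cast (Nat.floor_pos.2 hx).ne'
  exact log_div hfl (by linarith)

lemma tendsto_log_log_natFloor_exp_sub_log :
    Tendsto (fun u : ℝ => log (log ⌊exp u⌋₊) - log u) atTop (nhds 0) := by
  have h0 : Tendsto (fun u : ℝ => log ⌊exp u⌋₊ - u) atTop (nhds 0) := by
    simpa [Function.comp_def] using tendsto_log_natFloor_sub_log.comp tendsto_exp_atTop
  have h1 : Tendsto (fun u : ℝ => 1 + (log ⌊exp u⌋₊ - u) * u⁻¹) atTop (nhds 1) := by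
    simpa using (h0.mul tendsto_inv_atTop_zero).const_add 1
  have h2 := h1.log one_ne_zero
  rw [log_one] at h2
  refine h2.congr' ?_
  filter_upwards [eventually_gt_atTop 0, h1.eventually (lt_mem_nhds one_pos)] with u hu hpos
  have h : 1 + (log ⌊exp u⌋₊ - u) * u⁻¹ = log ⌊exp u⌋₊ / u := by
    field_simp
    ring
  rw [h] at hpos ⊢
  exact log_div ((div_pos_iff_of_pos_right hu).1 hpos).ne' hu.ne'

lemma tendsto_sum_inv_primesLE_sub_harmonic {M : ℝ}
    (hM : Tendsto (fun N : ℕ => ∑ p ∈ N.primesLE, (p : ℝ)⁻¹ - log (log N)) atTop (nhds M)) :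
    Tendsto (fun u : ℝ => ∑ p ∈ ⌊exp u⌋₊.primesLE, (p : ℝ)⁻¹ - (harmonic ⌊u⌋₊ : ℝ)) atTop
      (nhds (M - eulerMascheroniConstant)) := by
  have h1 := hM.comp (tendsto_nat_floor_atTop.comp tendsto_exp_atTop)
  have h2 := tendsto_harmonic_sub_log.comp (tendsto_nat_floor_atTop (α := ℝ))
  have h3 := ((h1.sub h2).add tendsto_log_log_natFloor_exp_sub_log).sub
    tendsto_log_natFloor_sub_log
  simp only [add_zero, sub_zero] at h3
  refine h3.congr fun u => ?_
  simp only [Function.comp_apply]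
  ring

lemma hasSum_ite_log_le_ite_prime {u : ℝ} :
    HasSum (fun n : ℕ => if log n ≤ u then (if n.Prime then (n : ℝ)⁻¹ else 0) else 0)
      (∑ p ∈ ⌊exp u⌋₊.primesLE, (p : ℝ)⁻¹) := by
  have h (n : ℕ) : (if log n ≤ u then (if n.Prime then (n : ℝ)⁻¹ else 0) else 0)
      = if n ∈ ⌊exp u⌋₊.primesLE then (n : ℝ)⁻¹ else 0 := by
    by_cases hn : n.Prime
    · have hn0 : (0 : ℝ) < n := by exact_mod_cast hn.pos
      simp [Nat.mem_primesLE, hn, Nat.le_floor_iff (exp_pos u).le, log_le_iff_le_exp hn0]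
    · simp [Nat.mem_primesLE, hn]
  simp only [h]
  convert hasSum_sum_of_ne_finset_zero (L := .unconditional ℕ) (s := ⌊exp u⌋₊.primesLE)
    (f := fun n : ℕ => if n ∈ ⌊exp u⌋₊.primesLE then (n : ℝ)⁻¹ else 0)
    (fun n hn => if_neg hn) using 1
  exact Finset.sum_congr rfl fun n hn => (if_pos hn).symm

lemma hasSum_ite_natCast_le_neg_inv {u : ℝ} (hu : 0 ≤ u) :
    HasSum (fun k : ℕ => if (k : ℝ) ≤ u then -(k : ℝ)⁻¹ else 0) (-(harmonic ⌊u⌋₊ : ℝ)) := by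
  have h (k : ℕ) : (if (k : ℝ) ≤ u then -(k : ℝ)⁻¹ else 0)
      = if k ∈ Finset.Icc 1 ⌊u⌋₊ then -(k : ℝ)⁻¹ else 0 := by
    rcases Nat.eq_zero_or_pos k with rfl | hk
    · simp
    · simp [Nat.le_floor_iff hu, Nat.succ_le_of_lt hk]
  simp only [h]
  convert hasSum_sum_of_ne_finset_zero (L := .unconditional ℕ) (s := Finset.Icc 1 ⌊u⌋₊)
    (f := fun k : ℕ => if k ∈ Finset.Icc 1 ⌊u⌋₊ then -(k : ℝ)⁻¹ else 0)
    (fun n hn => if_neg hn) using 1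
  rw [harmonic_eq_sum_Icc]
  push_cast
  rw [← Finset.sum_neg_distrib]
  exact Finset.sum_congr rfl fun n hn => (if_pos hn).symm

lemma hasSum_inv_mul_exp_neg {δ : ℝ} (hδ : 0 < δ) :
    HasSum (fun k : ℕ => (k : ℝ)⁻¹ * exp (-(δ * k))) (-log (1 - exp (-δ))) := by
  have hx : |exp (-δ)| < 1 := by
    rw [abs_of_pos (exp_pos _)]
    exact exp_lt_one_iff.2 (by linarith)
  have h := hasSum_pow_div_log_of_abs_lt_one hx
  rw [← hasSum_nat_add_iff' 1]
  simp only [Finset.range_one, Finset.sum_singleton, Nat.cast_zero, inv_zero, zero_mul, sub_zero]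
  refine h.congr_fun fun k => ?_
  rw [← exp_nat_mul]
  push_cast
  rw [div_eq_inv_mul]
  congr 2
  ring

lemma tendsto_log_one_sub_exp_neg_sub_log :
    Tendsto (fun δ : ℝ => log (1 - exp (-δ)) - log δ) (nhdsWithin 0 (Set.Ioi 0)) (nhds 0) := by
  have hd : HasDerivAt (fun δ : ℝ => 1 - exp (-δ)) 1 0 := by
    simpa using ((hasDerivAt_id (0 : ℝ)).neg.exp).const_sub 1
  have h := (hd.tendsto_slope_zero_right).log one_ne_zero
  rw [log_one] at h
  refine h.congr' ?_
  filter_upwards [self_mem_nhdsWithin] with δ hδ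
  have hδ0 : (0 : ℝ) < δ := hδ
  have h1 : 0 < 1 - exp (-δ) := sub_pos.2 (exp_lt_one_iff.2 (by linarith))
  rw [← log_div h1.ne' hδ0.ne']
  simp [div_eq_inv_mul]

lemma tendsto_tsum_prime_rpow_add_log_of_tendsto {M : ℝ}
    (hM : Tendsto (fun N : ℕ => ∑ p ∈ N.primesLE, (p : ℝ)⁻¹ - log (log N)) atTop (nhds M)) :
    Tendsto (fun δ : ℝ => ∑' n : ℕ, (if n.Prime then (n : ℝ) ^ (-(1 + δ)) else 0) + log δ)
      (nhdsWithin 0 (Set.Ioi 0)) (nhds (M - eulerMascheroniConstant)) := by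
  let w : ℕ ⊕ ℕ → ℝ := Sum.elim (fun n => if n.Prime then (n : ℝ)⁻¹ else 0) fun k => -(k : ℝ)⁻¹
  let l : ℕ ⊕ ℕ → ℝ := Sum.elim (fun n => log n) fun k => k
  have hprime (δ : ℝ) (n : ℕ) : (if n.Prime then (n : ℝ)⁻¹ else 0) * exp (-(δ * log n))
      = if n.Prime then (n : ℝ) ^ (-(1 + δ)) else 0 := by
    split_ifs with hn
    · have hn0 : (0 : ℝ) < n := by exact_mod_cast hn.pos
      rw [neg_add, rpow_add hn0, rpow_neg_one, rpow_def_of_pos hn0]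
      congr 2
      ring
    · simp
  have hsum1 (δ : ℝ) (hδ : 0 < δ) : HasSum ((fun i => w i * exp (-(δ * l i))) ∘ Sum.inl)
      (∑' n : ℕ, if n.Prime then (n : ℝ) ^ (-(1 + δ)) else 0) := by
    convert (summable_ite_prime_rpow (by linarith : 1 < 1 + δ)).hasSum using 1
    exact funext fun n => hprime δ n
  have hsum2 (δ : ℝ) (hδ : 0 < δ) : HasSum ((fun i => w i * exp (-(δ * l i))) ∘ Sum.inr)
      (log (1 - exp (-δ))) := by
    have h := (hasSum_inv_mul_exp_neg hδ).neg
    rw [neg_neg] at h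
    exact h.congr_fun fun k => neg_mul (k : ℝ)⁻¹ (exp (-(δ * k)))
  have habel := tendsto_tsum_mul_exp_neg_of_tendsto (w := w) (l := l)
    (D := fun u => ∑ p ∈ ⌊exp u⌋₊.primesLE, (p : ℝ)⁻¹ - (harmonic ⌊u⌋₊ : ℝ))
    (L := M - eulerMascheroniConstant) ?_ ?_ ?_ ?_ (tendsto_sum_inv_primesLE_sub_harmonic hM)
  · have h := habel.sub tendsto_log_one_sub_exp_neg_sub_log
    rw [sub_zero] at h
    refine h.congr' ?_
    filter_upwards [self_mem_nhdsWithin] with δ hδ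
    rw [((hsum1 δ hδ).sum (hsum2 δ hδ)).tsum_eq]
    ring
  · rintro (n | k)
    · exact log_natCast_nonneg n
    · exact k.cast_nonneg
  · intro δ hδ
    have h := ((hsum1 δ hδ).sum (hsum2 δ hδ)).summable.abs
    simpa only [abs_mul, abs_exp] using h
  · refine Measurable.sub ?_ ?_
    · exact (measurable_from_nat (f := fun N : ℕ => ∑ p ∈ N.primesLE, (p : ℝ)⁻¹)).comp
        (Nat.measurable_floor.comp measurable_exp)
    · exact (measurable_from_nat (f := fun N : ℕ => (harmonic N : ℝ))).comp Nat.measurable_floor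
  · intro u hu
    rw [sub_eq_add_neg]
    exact HasSum.sum hasSum_ite_log_le_ite_prime (hasSum_ite_natCast_le_neg_inv hu)

/-- Mertens' third theorem, in logarithmic form. -/
theorem tendsto_sum_neg_log_one_sub_inv_sub_log_log :
    Tendsto (fun N : ℕ => ∑ p ∈ N.primesLE, -log (1 - (p : ℝ)⁻¹) - log (log N)) atTop
      (nhds eulerMascheroniConstant) := by
  obtain ⟨M, hM⟩ := exists_tendsto_sum_inv_primesLE_sub_log_log
  have hconst := tendsto_nhds_unique (tendsto_tsum_prime_rpow_add_log_of_tendsto hM)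
    tendsto_tsum_prime_rpow_add_log
  have hrem : Tendsto (fun N : ℕ => ∑ p ∈ N.primesLE, logRemainder (p : ℝ)⁻¹) atTop
      (nhds (∑' n : ℕ, if n.Prime then logRemainder (n : ℝ)⁻¹ else 0)) := by
    have hs := summable_ite_prime_logRemainder le_rfl
    simp only [rpow_neg_one] at hs
    refine ((tendsto_add_atTop_iff_nat 1).2 hs.hasSum.tendsto_sum_nat).congr fun N => ?_
    rw [Nat.primesLE_eq_filter_range, Finset.sum_filter]
  convert hM.add hrem using 1
  · funext N
    simp only [neg_log_one_sub, Finset.sum_add_distrib]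
    ring
  · congr 1
    linarith

/-- Mertens' third theorem. -/
theorem tendsto_prod_one_sub_inv_mul_log :
    Tendsto (fun N : ℕ => (∏ p ∈ N.primesLE, (1 - (p : ℝ)⁻¹)) * log N) atTop
      (nhds (exp (-eulerMascheroniConstant))) := by
  refine (tendsto_sum_neg_log_one_sub_inv_sub_log_log.neg.rexp).congr' ?_
  filter_upwards [eventually_ge_atTop 2] with N hN
  have hN2 : (2 : ℝ) ≤ N := by exact_mod_cast hN
  rw [neg_sub, sub_eq_add_neg, ← Finset.sum_neg_distrib, exp_add, exp_log (log_pos (by linarith)),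
    exp_sum, mul_comm]
  congr 1
  refine Finset.prod_congr rfl fun p hp => ?_
  have := inv_le_half_of_prime (Nat.prime_of_mem_primesLE hp)
  rw [neg_neg, exp_log (by linarith)]

lemma tendsto_prod_one_sub_inv :
    Tendsto (fun N : ℕ => ∏ p ∈ N.primesLE, (1 - (p : ℝ)⁻¹)) atTop (nhds 0) := by
  have h := tendsto_prod_one_sub_inv_mul_log.mul
    (tendsto_inv_atTop_zero.comp (tendsto_log_atTop.comp tendsto_natCast_atTop_atTop))
  rw [mul_zero] at h
  refine h.congr' ?_
  filter_upwards [eventually_ge_atTop 2] with N hN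
  have hN2 : (2 : ℝ) ≤ N := by exact_mod_cast hN
  exact mul_inv_cancel_right₀ (log_pos (by linarith)).ne' _

lemma tendsto_prod_one_sub_inv_mul_log_add (c : ℝ) :
    Tendsto (fun N : ℕ => (∏ p ∈ N.primesLE, (1 - (p : ℝ)⁻¹)) * (log N + c)) atTop
      (nhds (exp (-eulerMascheroniConstant))) := by
  simpa [mul_add] using tendsto_prod_one_sub_inv_mul_log.add (tendsto_prod_one_sub_inv.mul_const c)

lemma tendsto_prod_one_sub_inv_natFloor_mul_log_add (c : ℝ) :
    Tendsto (fun x : ℝ => (∏ p ∈ ⌊x⌋₊.primesLE, (1 - (p : ℝ)⁻¹)) * (log x + c)) atTop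
      (nhds (exp (-eulerMascheroniConstant))) := by
  have hfl := tendsto_nat_floor_atTop (α := ℝ)
  have h := ((tendsto_prod_one_sub_inv_mul_log_add c).comp hfl).sub
    ((tendsto_prod_one_sub_inv.comp hfl).mul tendsto_log_natFloor_sub_log)
  rw [mul_zero, sub_zero] at h
  refine h.congr fun x => ?_
  simp only [Function.comp_apply]
  ring

lemma one_sub_inv_natCast_nonneg (p : ℕ) : 0 ≤ 1 - (p : ℝ)⁻¹ :=
  sub_nonneg.2 (Nat.cast_inv_le_one p)

lemma one_sub_inv_natCast_le_one (p : ℕ) : 1 - (p : ℝ)⁻¹ ≤ 1 := by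
  have : (0 : ℝ) ≤ (p : ℝ)⁻¹ := by positivity
  linarith

lemma prod_one_sub_inv_anti {s t : Finset ℕ} (h : s ⊆ t) :
    ∏ p ∈ t, (1 - (p : ℝ)⁻¹) ≤ ∏ p ∈ s, (1 - (p : ℝ)⁻¹) := by
  rw [← Finset.prod_sdiff h]
  exact mul_le_of_le_one_left (Finset.prod_nonneg fun p _ => one_sub_inv_natCast_nonneg p)
    (Finset.prod_le_one (fun p _ => one_sub_inv_natCast_nonneg p)
      fun p _ => one_sub_inv_natCast_le_one p)

lemma totient_div_self_eq_prod {m : ℕ} (hm : m ≠ 0) :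
    (m.totient : ℝ) / m = ∏ p ∈ m.primeFactors, (1 - (p : ℝ)⁻¹) := by
  have h : (m.totient : ℝ) = m * ∏ p ∈ m.primeFactors, (1 - (p : ℝ)⁻¹) := by
    simpa using congrArg (fun q : ℚ => (q : ℝ)) (Nat.totient_eq_mul_prod_factors m)
  rw [h, mul_div_cancel_left₀ _ (by exact_mod_cast hm)]

/-- The primes exceeding `log m` contribute little to `φ(m) / m`. -/
lemma one_sub_inv_log_log_le_prod {m : ℕ} (hm : 1 < log m) {s : Finset ℕ}
    (hs : s ⊆ m.primeFactors) (hlt : ∀ p ∈ s, log m < p) :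
    1 - (log (log m))⁻¹ ≤ ∏ p ∈ s, (1 - (p : ℝ)⁻¹) := by
  have hm0 : m ≠ 0 := by
    rintro rfl
    norm_num at hm
  have hL0 : 0 < log (m : ℝ) := by linarith
  have hLL : 0 < log (log (m : ℝ)) := log_pos hm
  have hpow : log (m : ℝ) ^ s.card ≤ m := by
    have h1 : ∏ p ∈ s, p ≤ m :=
      Nat.le_of_dvd (Nat.pos_of_ne_zero hm0)
        ((Finset.prod_dvd_prod_of_subset _ _ _ hs).trans (Nat.prod_primeFactors_dvd m))
    calc log (m : ℝ) ^ s.card = ∏ _p ∈ s, log (m : ℝ) := by rw [Finset.prod_const]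
      _ ≤ ∏ p ∈ s, (p : ℝ) := Finset.prod_le_prod (fun _ _ => hL0.le) fun p hp => (hlt p hp).le
      _ ≤ m := by
        rw [← Nat.cast_prod]
        exact Nat.cast_le.2 h1
  have hcard : s.card * log (log (m : ℝ)) ≤ log m := by
    rw [← log_pow]
    exact log_le_log (by positivity) hpow
  have hbern := one_add_mul_le_pow (a := -(log (m : ℝ))⁻¹)
    (by have := inv_le_one_of_one_le₀ hm.le; linarith) s.card
  calc 1 - (log (log (m : ℝ)))⁻¹ ≤ 1 + s.card * -(log (m : ℝ))⁻¹ := by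
        have h2 : s.card * (log (m : ℝ))⁻¹ ≤ (log (log (m : ℝ)))⁻¹ := by
          rw [← div_eq_mul_inv, inv_eq_one_div, div_le_div_iff₀ hL0 hLL]
          linarith
        linarith
    _ ≤ (1 + -(log (m : ℝ))⁻¹) ^ s.card := hbern
    _ = ∏ _p ∈ s, (1 + -(log (m : ℝ))⁻¹) := by rw [Finset.prod_const]
    _ ≤ ∏ p ∈ s, (1 - (p : ℝ)⁻¹) := by
        refine Finset.prod_le_prod (fun _ _ => ?_) fun p hp => ?_
        · have := inv_le_one_of_one_le₀ hm.le
          linarith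
        · have := inv_anti₀ hL0 (hlt p hp).le
          linarith

lemma prod_mul_one_sub_inv_log_log_le_totient_div {m : ℕ} (hm : 1 < log m) :
    (∏ p ∈ ⌊log m⌋₊.primesLE, (1 - (p : ℝ)⁻¹)) * (1 - (log (log m))⁻¹) ≤ m.totient / m := by
  have hm0 : m ≠ 0 := by
    rintro rfl
    norm_num at hm
  rw [totient_div_self_eq_prod hm0,
    ← Finset.prod_filter_mul_prod_filter_not m.primeFactors (fun p => p ≤ ⌊log m⌋₊)]
  have h1 : ∏ p ∈ ⌊log m⌋₊.primesLE, (1 - (p : ℝ)⁻¹)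
      ≤ ∏ p ∈ m.primeFactors with p ≤ ⌊log m⌋₊, (1 - (p : ℝ)⁻¹) :=
    prod_one_sub_inv_anti fun p hp => by
      rw [Finset.mem_filter] at hp
      exact Nat.mem_primesLE.2 ⟨hp.2, Nat.prime_of_mem_primeFactors hp.1⟩
  have h2 := one_sub_inv_log_log_le_prod hm
    (Finset.filter_subset (fun p => ¬ p ≤ ⌊log m⌋₊) m.primeFactors) fun p hp => by
      rw [Finset.mem_filter, not_le] at hp
      exact Nat.lt_of_floor_lt hp.2
  refine (mul_le_mul_of_nonneg_left h2 ?_).trans (mul_le_mul_of_nonneg_right h1 ?_) <;>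
  exact Finset.prod_nonneg fun p _ => one_sub_inv_natCast_nonneg p

lemma dedekindPsi_pos (n : ℕ) : 0 < dedekindPsi n := by
  rw [dedekindPsi, Finsupp.prod]
  refine Finset.prod_pos fun p hp => ?_
  have := (Nat.prime_of_mem_primeFactors hp).pos
  positivity

lemma le_dedekindPsi (n : ℕ) : n ≤ dedekindPsi n := by
  rcases eq_or_ne n 0 with rfl | hn
  · exact Nat.zero_le _
  conv_lhs => rw [← Nat.prod_factorization_pow_eq_self hn]
  refine Finset.prod_le_prod' fun p hp => ?_
  obtain ⟨a, ha⟩ := Nat.exists_eq_succ_of_ne_zero (Finsupp.mem_support_iff.1 hp)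
  simp only [ha, Nat.succ_eq_add_one, Nat.add_sub_cancel, pow_succ]
  exact Nat.mul_le_mul_left _ (Nat.le_succ p)

lemma dedekindPsi_le_sq {n : ℕ} (hn : n ≠ 0) : dedekindPsi n ≤ n ^ 2 := by
  conv_rhs => rw [← Nat.prod_factorization_pow_eq_self hn]
  rw [dedekindPsi, Finsupp.prod, Finsupp.prod, ← Finset.prod_pow]
  refine Finset.prod_le_prod' fun p hp => ?_
  obtain ⟨a, ha⟩ := Nat.exists_eq_succ_of_ne_zero (Finsupp.mem_support_iff.1 hp)
  have hp2 := (Nat.prime_of_mem_primeFactors hp).two_le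
  have h1 : 1 ≤ p ^ a := Nat.one_le_pow _ _ (by omega)
  simp only [ha, Nat.succ_eq_add_one, Nat.add_sub_cancel]
  calc p ^ a * (p + 1) ≤ p ^ a * (p * p) := Nat.mul_le_mul_left _ (by nlinarith)
    _ ≤ p ^ a * (p * p) * p ^ a := Nat.le_mul_of_pos_right _ h1
    _ = (p ^ (a + 1)) ^ 2 := by ring

lemma pow_dvd_dedekindPsi {p a n : ℕ} (hp : p.Prime) (hn : n ≠ 0) (h : p ^ (a + 1) ∣ n) :
    p ^ a ∣ dedekindPsi n := by
  have hf : a + 1 ≤ n.factorization p := (hp.pow_dvd_iff_le_factorization hn).1 h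
  have hmem : p ∈ n.factorization.support := Finsupp.mem_support_iff.2 (by omega)
  refine dvd_trans ?_ (Finset.dvd_prod_of_mem
    (fun q => q ^ (n.factorization q - 1) * (q + 1)) hmem)
  exact (pow_dvd_pow p (by omega)).mul_right _

lemma dedekindPsi_iterate_ne_zero (k : ℕ) {n : ℕ} (hn : n ≠ 0) : dedekindPsi^[k] n ≠ 0 := by
  induction k generalizing n with
  | zero => exact hn
  | succ k ih => exact ih (dedekindPsi_pos n).ne'

lemma le_dedekindPsi_iterate (k n : ℕ) : n ≤ dedekindPsi^[k] n :=
  Function.id_le_iterate_of_id_le le_dedekindPsi k n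

lemma dedekindPsi_iterate_le_pow (k : ℕ) {n : ℕ} (hn : n ≠ 0) :
    dedekindPsi^[k] n ≤ n ^ 2 ^ k := by
  induction k generalizing n with
  | zero => simp
  | succ k ih =>
    calc dedekindPsi^[k] (dedekindPsi n) ≤ dedekindPsi n ^ 2 ^ k := ih (dedekindPsi_pos n).ne'
      _ ≤ (n ^ 2) ^ 2 ^ k := Nat.pow_le_pow_left (dedekindPsi_le_sq hn) _
      _ = n ^ 2 ^ (k + 1) := by rw [← pow_mul, pow_succ' 2 k]

lemma pow_dvd_dedekindPsi_iterate {p a : ℕ} (hp : p.Prime) (k : ℕ) {n : ℕ} (hn : n ≠ 0)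
    (h : p ^ (a + k) ∣ n) : p ^ a ∣ dedekindPsi^[k] n := by
  induction k generalizing n with
  | zero => exact h
  | succ k ih => exact ih (dedekindPsi_pos n).ne' (pow_dvd_dedekindPsi hp hn h)

lemma tendsto_primorial_atTop : Tendsto primorial atTop atTop :=
  tendsto_atTop_mono (fun _ => le_primorial_self) tendsto_id

lemma totient_div_iterate_primorial_pow_le (k y : ℕ) :
    ((dedekindPsi^[k] (primorial y ^ (k + 1))).totient : ℝ) / dedekindPsi^[k] (primorial y ^ (k + 1))
      ≤ ∏ p ∈ y.primesLE, (1 - (p : ℝ)⁻¹) := by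
  have hn : primorial y ^ (k + 1) ≠ 0 := pow_ne_zero _ (primorial_pos y).ne'
  rw [totient_div_self_eq_prod (dedekindPsi_iterate_ne_zero k hn)]
  refine prod_one_sub_inv_anti fun p hp => ?_
  have hpp := Nat.prime_of_mem_primesLE hp
  refine Nat.mem_primeFactors.2 ⟨hpp, ?_, dedekindPsi_iterate_ne_zero k hn⟩
  rw [← pow_one p]
  refine pow_dvd_dedekindPsi_iterate hpp k hn ?_
  rw [add_comm 1 k, primorial_eq_prod_primesLE]
  exact pow_dvd_pow_of_dvd (Finset.dvd_prod_of_mem _ hp) _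

lemma log_log_primorial_pow_le (k : ℕ) {y : ℕ} (hy : 2 ≤ y) :
    log (log ((primorial y ^ (k + 1) : ℕ) : ℝ)) ≤ log y + log ((k + 1) * log 4) := by
  have hy0 : (0 : ℝ) < y := by exact_mod_cast (by omega : 0 < y)
  have h4 : 0 < log 4 := log_pos (by norm_num)
  have htheta : log (primorial y : ℝ) = Chebyshev.theta y := by
    rw [Chebyshev.theta_eq_log_primorial, Nat.floor_natCast]
  have hpos : 0 < Chebyshev.theta y := Chebyshev.theta_pos (by exact_mod_cast hy)
  have hk : (0 : ℝ) < k + 1 := by positivity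
  push_cast
  rw [log_pow, htheta, ← log_mul hy0.ne' (by positivity)]
  push_cast
  refine log_le_log (by positivity) ?_
  have := mul_le_mul_of_nonneg_left (Chebyshev.theta_le_log4_mul_x hy0.le) hk.le
  linarith

lemma log_log_dedekindPsi_iterate_le (k : ℕ) {n : ℕ} (hn : 2 ≤ n) :
    log (log (dedekindPsi^[k] n : ℝ)) - k * log 2 ≤ log (log (n : ℝ)) := by
  have hn2 : (2 : ℝ) ≤ n := by exact_mod_cast hn
  have hle : (n : ℝ) ≤ dedekindPsi^[k] n := by exact_mod_cast le_dedekindPsi_iterate k n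
  have hpow : (dedekindPsi^[k] n : ℝ) ≤ (n : ℝ) ^ 2 ^ k := by
    exact_mod_cast dedekindPsi_iterate_le_pow k (by omega)
  have hlog : 0 < log (n : ℝ) := log_pos (by linarith)
  have h1 := log_le_log (by linarith) hpow
  rw [log_pow] at h1
  have h2 := log_le_log (log_pos (by linarith)) h1
  push_cast at h2
  rw [log_mul (by positivity) hlog.ne', log_pow] at h2
  linarith

theorem liminf_phi_psi_iterate (k : ℕ) :
    liminf (fun n : ℕ =>
        (Nat.totient (dedekindPsi^[k] n) : ℝ) * Real.log (Real.log n) / dedekindPsi^[k] n) atTop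
      = Real.exp (-Real.eulerMascheroniConstant) := by
  set f : ℕ → ℝ := fun n =>
    (Nat.totient (dedekindPsi^[k] n) : ℝ) * log (log n) / dedekindPsi^[k] n with hf
  have hf' (n : ℕ) : f n
      = (Nat.totient (dedekindPsi^[k] n) : ℝ) / dedekindPsi^[k] n * log (log n) :=
    mul_div_right_comm _ _ _
  let g : ℝ → ℝ := fun x => (∏ p ∈ ⌊x⌋₊.primesLE, (1 - (p : ℝ)⁻¹)) * (log x + -(k * log 2))
    * (1 - (log x)⁻¹)
  have hg : Tendsto g atTop (nhds (exp (-eulerMascheroniConstant))) := by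
    simpa using (tendsto_prod_one_sub_inv_natFloor_mul_log_add (-(k * log 2))).mul
      ((tendsto_inv_atTop_zero.comp tendsto_log_atTop).const_sub 1)
  have hL : Tendsto (fun n : ℕ => log (dedekindPsi^[k] n : ℝ)) atTop atTop :=
    tendsto_log_atTop.comp (tendsto_natCast_atTop_atTop.comp
      (tendsto_atTop_mono (le_dedekindPsi_iterate k) tendsto_id))
  have hgf : ∀ᶠ n : ℕ in atTop, g (log (dedekindPsi^[k] n : ℝ)) ≤ f n := by
    filter_upwards [eventually_ge_atTop 2, hL.eventually_gt_atTop 1,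
      (tendsto_log_atTop.comp hL).eventually_ge_atTop (k * log 2)] with n hn hn1 hn2
    rw [hf' n, show g _ = _ from mul_right_comm _ _ _]
    exact mul_le_mul (prod_mul_one_sub_inv_log_log_le_totient_div hn1)
      (log_log_dedekindPsi_iterate_le k hn) (by simpa using hn2) (by positivity)
  let N : ℕ → ℕ := fun y => primorial y ^ (k + 1)
  have hN : Tendsto N atTop atTop := (tendsto_pow_atTop k.succ_ne_zero).comp tendsto_primorial_atTop
  have hup : ∀ᶠ y : ℕ in atTop, f (N y)
      ≤ (∏ p ∈ y.primesLE, (1 - (p : ℝ)⁻¹)) * (log y + log ((k + 1) * log 4)) := by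
    filter_upwards [eventually_ge_atTop 2, hN.eventually ((tendsto_log_atTop.comp
      (tendsto_log_atTop.comp tendsto_natCast_atTop_atTop)).eventually_ge_atTop 0)] with y hy hy0
    rw [hf']
    exact mul_le_mul (totient_div_iterate_primorial_pow_le k y) (log_log_primorial_pow_le k hy) hy0
      (Finset.prod_nonneg fun p _ => one_sub_inv_natCast_nonneg p)
  have hlow {a : ℝ} (ha : a < exp (-eulerMascheroniConstant)) : ∀ᶠ n in atTop, a ≤ f n := by
    filter_upwards [hgf, (hg.comp hL).eventually (lt_mem_nhds ha)] with n h1 h2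
    exact h2.le.trans h1
  have hfreq {b : ℝ} (hb : exp (-eulerMascheroniConstant) < b) : ∃ᶠ n in atTop, f n ≤ b := by
    refine hN.frequently (Eventually.frequently ?_)
    filter_upwards [hup, (tendsto_prod_one_sub_inv_mul_log_add (log ((k + 1) * log 4))).eventually
      (gt_mem_nhds hb)] with y h1 h2
    exact h1.trans h2.le
  have hbdd : IsBoundedUnder (· ≥ ·) atTop f :=
    isBoundedUnder_of_eventually_ge (hlow (sub_one_lt _))
  have hcobdd : IsCoboundedUnder (· ≥ ·) atTop f :=
    IsCoboundedUnder.of_frequently_le (hfreq (lt_add_one _))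
  refine le_antisymm (le_of_forall_gt_imp_ge_of_dense fun b hb => ?_)
    (le_of_forall_lt_imp_le_of_dense fun a ha => ?_)
  · exact liminf_le_of_frequently_le (hfreq hb) hbdd
  · exact le_liminf_of_le hcobdd (hlow ha)
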